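/- (Truth lemma) Let Ax ⊆ L⇛ be consistent and Σ ⊆ L⇛ contain ⊤ and be closed under subformulas. Then for every φ ∈ Σ and every (Ax,Σ)-segment (Γ, U): M_{Ax,Σ}, (Γ,U) ⊨ φ if and only if φ ∈ Γ, where M_{Ax,Σ} is the full canonical model. -/

import Mathlib

/-- Formulas of the language `L⇛`. -/
inductive Fml : Type where
  | var : Nat → Fml
  | top : Fml
  | bot : Fml
  | and : Fml → Fml → Fml
  | or  : Fml → Fml → Fml
  | imp : Fml → Fml → Fml
  | sto : Fml → Fml → Fml
deriving DecidableEq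

/-- Uniform substitution. -/
def Fml.subst (σ : Nat → Fml) : Fml → Fml
  | .var p => σ p
  | .top => .top
  | .bot => .bot
  | .and φ ψ => .and (φ.subst σ) (ψ.subst σ)
  | .or φ ψ => .or (φ.subst σ) (ψ.subst σ)
  | .imp φ ψ => .imp (φ.subst σ) (ψ.subst σ)
  | .sto φ ψ => .sto (φ.subst σ) (ψ.subst σ)

/-- Conjunction `φ₁ ∧ ⋯ ∧ φₙ` of a list of formulas (`⊤` for the empty list). -/
def Fml.conj : List Fml → Fml
  | [] => .top
  | [φ] => φ
  | φ :: ψ :: rest => .and φ (Fml.conj (ψ :: rest))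

/-- Disjunction `φ₁ ∨ ⋯ ∨ φₙ` of a list of formulas (`⊥` for the empty list). -/
def Fml.disj : List Fml → Fml
  | [] => .bot
  | [φ] => φ
  | φ :: ψ :: rest => .or φ (Fml.disj (ψ :: rest))

/-- Axiom schemes of intuitionistic propositional logic (a standard Hilbert-style
axiomatisation); as schemes, they comprise all substitution instances. -/
inductive IpcAx : Fml → Prop where
  | k (φ ψ : Fml) : IpcAx (.imp φ (.imp ψ φ))
  | s (φ ψ χ : Fml) : IpcAx (.imp (.imp φ (.imp ψ χ)) (.imp (.imp φ ψ) (.imp φ χ)))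
  | andE1 (φ ψ : Fml) : IpcAx (.imp (.and φ ψ) φ)
  | andE2 (φ ψ : Fml) : IpcAx (.imp (.and φ ψ) ψ)
  | andI (φ ψ : Fml) : IpcAx (.imp φ (.imp ψ (.and φ ψ)))
  | orI1 (φ ψ : Fml) : IpcAx (.imp φ (.or φ ψ))
  | orI2 (φ ψ : Fml) : IpcAx (.imp ψ (.or φ ψ))
  | orE (φ ψ χ : Fml) : IpcAx (.imp (.imp φ χ) (.imp (.imp ψ χ) (.imp (.or φ ψ) χ)))
  | botE (φ : Fml) : IpcAx (.imp .bot φ)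
  | top : IpcAx .top

/-- Substitution instances of the axioms of intuitionistic logic together with
`k_a : ((p⇛q)∧(p⇛r))→(p⇛(q∧r))` and `tr : ((p⇛q)∧(q⇛r))→(p⇛r)`. -/
inductive BaseAx : Fml → Prop where
  | ipc {φ : Fml} : IpcAx φ → BaseAx φ
  | ka (φ ψ χ : Fml) : BaseAx (.imp (.and (.sto φ ψ) (.sto φ χ)) (.sto φ (.and ψ χ)))
  | tr (φ ψ χ : Fml) : BaseAx (.imp (.and (.sto φ ψ) (.sto ψ χ)) (.sto φ χ))

/-- Derivability of the consecution `Γ ⇒ φ` in `HLC♭ ⊕ Ax`, i.e. `Γ ⊢_Ax φ`. -/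
inductive Deriv (Ax : Set Fml) : Set Fml → Fml → Prop where
  | base {Γ : Set Fml} {φ : Fml} : BaseAx φ → Deriv Ax Γ φ
  | axm {Γ : Set Fml} {ψ : Fml} (σ : Nat → Fml) : ψ ∈ Ax → Deriv Ax Γ (ψ.subst σ)
  | el {Γ : Set Fml} {φ : Fml} : φ ∈ Γ → Deriv Ax Γ φ
  | mp {Γ : Set Fml} {φ ψ : Fml} : Deriv Ax Γ φ → Deriv Ax Γ (.imp φ ψ) → Deriv Ax Γ ψ
  | na {Γ : Set Fml} {φ ψ : Fml} : Deriv Ax (∅ : Set Fml) (.imp φ ψ) → Deriv Ax Γ (.sto φ ψ)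

/-- `Γ ⊢_Ax Δ`: there are `ψ₁, …, ψₘ ∈ Δ` (m ≥ 1) with `Γ ⊢_Ax ψ₁ ∨ ⋯ ∨ ψₘ`. -/
def DerivDisj (Ax Γ Δ : Set Fml) : Prop :=
  ∃ L : List Fml, L ≠ [] ∧ (∀ ψ ∈ L, ψ ∈ Δ) ∧ Deriv Ax Γ (Fml.disj L)

/-- A set of axioms is consistent if it does not derive `⊥`. -/
def Consistent (Ax : Set Fml) : Prop := ¬ Deriv Ax (∅ : Set Fml) .bot

/-- A prime `Ax`-theory: deductively closed, consistent, and prime. -/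
def IsPrimeTheory (Ax Γ : Set Fml) : Prop :=
  (∀ φ, Deriv Ax Γ φ → φ ∈ Γ) ∧
  ¬ Deriv Ax Γ .bot ∧
  (∀ L : List Fml, L ≠ [] → Deriv Ax Γ (Fml.disj L) → ∃ φ ∈ L, φ ∈ Γ)

/-- `S` is closed under subformulas. -/
def SubfClosed (S : Set Fml) : Prop :=
  (∀ φ ψ : Fml, Fml.and φ ψ ∈ S → φ ∈ S ∧ ψ ∈ S) ∧
  (∀ φ ψ : Fml, Fml.or φ ψ ∈ S → φ ∈ S ∧ ψ ∈ S) ∧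
  (∀ φ ψ : Fml, Fml.imp φ ψ ∈ S → φ ∈ S ∧ ψ ∈ S) ∧
  (∀ φ ψ : Fml, Fml.sto φ ψ ∈ S → φ ∈ S ∧ ψ ∈ S)

/-- A prime `(Ax,S)`-theory: a subset of `S` that is deductively closed within `S`,
consistent, and `S`-prime. -/
def PrimeTheoryIn (Ax S Γ : Set Fml) : Prop :=
  Γ ⊆ S ∧
  (∀ φ ∈ S, Deriv Ax Γ φ → φ ∈ Γ) ∧
  ¬ Deriv Ax Γ .bot ∧
  (∀ L : List Fml, L ≠ [] → (∀ ψ ∈ L, ψ ∈ S) → Deriv Ax Γ (Fml.disj L) →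
    ∃ φ ∈ L, φ ∈ Γ)

/-- `(Γ, U)` is an `(Ax,S)`-segment: `Γ` and all members of `U` are prime
`(Ax,S)`-theories, `U` is closed upwards under inclusion among prime
`(Ax,S)`-theories (S1), and for all `φ, ψ ∈ S`, if `Γ ⊢_Ax φ⇛ψ` and `φ` belongs to
every member of `U`, then so does `ψ` (S2). -/
def IsSegment (Ax S : Set Fml) (Γ : Set Fml) (U : Set (Set Fml)) : Prop :=
  PrimeTheoryIn Ax S Γ ∧
  (∀ Δ ∈ U, PrimeTheoryIn Ax S Δ) ∧
  (∀ Δ ∈ U, ∀ Δ', PrimeTheoryIn Ax S Δ' → Δ ⊆ Δ' → Δ' ∈ U) ∧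
  (∀ φ ψ : Fml, φ ∈ S → ψ ∈ S → Deriv Ax Γ (.sto φ ψ) →
    (∀ Δ ∈ U, φ ∈ Δ) → ∀ Δ ∈ U, ψ ∈ Δ)

/-- The type of `(Ax,S)`-segments. -/
def Segment (Ax S : Set Fml) : Type :=
  {p : Set Fml × Set (Set Fml) // IsSegment Ax S p.1 p.2}

/-- Truth at a segment `(Γ,U)` of the full canonical model `M_{Ax,S}`:
`(Γ,U) ≼ (Γ',U')` iff `Γ ⊆ Γ'`, `(Γ,U) R (Γ',U')` iff `Γ' ∈ U`, and
`V(p) = {(Γ,U) | p ∈ Γ}`. -/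
def canonSat (Ax S : Set Fml) : Fml → Segment Ax S → Prop
  | .var p, w => Fml.var p ∈ w.1.1
  | .top, _ => True
  | .bot, _ => False
  | .and φ ψ, w => canonSat Ax S φ w ∧ canonSat Ax S ψ w
  | .or φ ψ, w => canonSat Ax S φ w ∨ canonSat Ax S ψ w
  | .imp φ ψ, w => ∀ v : Segment Ax S, w.1.1 ⊆ v.1.1 →
      canonSat Ax S φ v → canonSat Ax S ψ v
  | .sto φ ψ, w => ∀ w' : Segment Ax S, w.1.1 ⊆ w'.1.1 →
      (∀ v : Segment Ax S, v.1.1 ∈ w'.1.2 → canonSat Ax S φ v) →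
      ∀ v : Segment Ax S, v.1.1 ∈ w'.1.2 → canonSat Ax S ψ v

/-- The single negation `∼φ`: `ψ` if `φ = ¬ψ`, and `¬φ` otherwise. -/
def Fml.sneg : Fml → Fml
  | .imp ψ .bot => ψ
  | φ => .imp φ .bot

/-- `S` is closed under single negations. -/
def SnClosed (S : Set Fml) : Prop := ∀ φ ∈ S, Fml.sneg φ ∈ S

namespace Deriv

variable {Ax Γ Γ' : Set Fml} {φ ψ χ : Fml}

theorem mono (h : Deriv Ax Γ φ) (hs : Γ ⊆ Γ') : Deriv Ax Γ' φ := by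
  induction h with
  | base h => exact .base h
  | axm σ h => exact .axm σ h
  | el h => exact .el (hs h)
  | mp _ _ ih₁ ih₂ => exact .mp (ih₁ hs) (ih₂ hs)
  | na h _ => exact .na h

theorem weaken (φ : Fml) (h : Deriv Ax Γ ψ) : Deriv Ax Γ (.imp φ ψ) :=
  .mp h (.base (.ipc (.k ψ φ)))

theorem imp_refl (φ : Fml) : Deriv Ax Γ (.imp φ φ) :=
  .mp (.base (.ipc (.k φ φ)))
    (.mp (.base (.ipc (.k φ (.imp φ φ)))) (.base (.ipc (.s φ (.imp φ φ) φ))))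

theorem imp_mp (h₁ : Deriv Ax Γ (.imp φ ψ)) (h₂ : Deriv Ax Γ (.imp φ (.imp ψ χ))) :
    Deriv Ax Γ (.imp φ χ) :=
  .mp h₁ (.mp h₂ (.base (.ipc (.s φ ψ χ))))

theorem and_intro (h₁ : Deriv Ax Γ φ) (h₂ : Deriv Ax Γ ψ) : Deriv Ax Γ (.and φ ψ) :=
  .mp h₂ (.mp h₁ (.base (.ipc (.andI φ ψ))))

/-- The deduction theorem. -/
theorem deduction (h : Deriv Ax (insert φ Γ) ψ) : Deriv Ax Γ (.imp φ ψ) := by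
  generalize hΔ : insert φ Γ = Δ at h
  induction h with
  | base h => exact weaken φ (.base h)
  | axm σ h => exact weaken φ (.axm σ h)
  | el h =>
    subst hΔ
    rcases h with rfl | h
    · exact imp_refl _
    · exact weaken φ (.el h)
  | mp _ _ ih₁ ih₂ => exact imp_mp (ih₁ hΔ) (ih₂ hΔ)
  | na h _ => exact weaken φ (.na h)

theorem exists_mem_of_sUnion {c : Set (Set Fml)} (hc : IsChain (· ⊆ ·) c) (hne : c.Nonempty)
    (h : Deriv Ax (⋃₀ c) φ) : ∃ s ∈ c, Deriv Ax s φ := by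
  generalize hΔ : ⋃₀ c = Δ at h
  induction h with
  | base h => exact hne.imp fun s hs => ⟨hs, .base h⟩
  | axm σ h => exact hne.imp fun s hs => ⟨hs, .axm σ h⟩
  | el h =>
    subst hΔ
    obtain ⟨s, hs, h⟩ := h
    exact ⟨s, hs, .el h⟩
  | mp _ _ ih₁ ih₂ =>
    obtain ⟨s, hs, h₁⟩ := ih₁ hΔ
    obtain ⟨t, ht, h₂⟩ := ih₂ hΔ
    rcases hc.total hs ht with hst | hts
    · exact ⟨t, ht, .mp (h₁.mono hst) h₂⟩
    · exact ⟨s, hs, .mp h₁ (h₂.mono hts)⟩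
  | na h _ => exact hne.imp fun s hs => ⟨hs, .na h⟩

theorem disj_elim (L : List Fml) (h : ∀ ψ ∈ L, Deriv Ax Γ (.imp ψ χ)) :
    Deriv Ax Γ (.imp (Fml.disj L) χ) := by
  induction L with
  | nil => exact .base (.ipc (.botE χ))
  | cons φ L ih =>
    cases L with
    | nil => exact h φ (by simp)
    | cons ψ L =>
      exact .mp (ih fun θ hθ => h θ (List.mem_cons_of_mem _ hθ))
        (.mp (h φ (by simp)) (.base (.ipc (.orE φ _ χ))))

theorem sto_trans (h₁ : Deriv Ax Γ (.sto φ ψ)) (h₂ : Deriv Ax Γ (.sto ψ χ)) :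
    Deriv Ax Γ (.sto φ χ) :=
  .mp (and_intro h₁ h₂) (.base (.tr φ ψ χ))

/-- The `⇛`-consequences of `φ` over `Γ` are closed under derivability. -/
theorem sto_of_forall {T : Set Fml} (hT : ∀ θ ∈ T, Deriv Ax Γ (.sto φ θ))
    (h : Deriv Ax T χ) : Deriv Ax Γ (.sto φ χ) := by
  induction h with
  | base h => exact .na (weaken φ (.base h))
  | axm σ h => exact .na (weaken φ (.axm σ h))
  | el h => exact hT _ h
  | @mp _ α β _ _ ih₁ ih₂ =>
    have hmp : Deriv Ax ∅ (.imp (.and α (.imp α β)) β) :=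
      imp_mp (.base (.ipc (.andE1 _ _))) (.base (.ipc (.andE2 _ _)))
    exact sto_trans (.mp (and_intro (ih₁ hT) (ih₂ hT)) (.base (.ka _ _ _))) (.na hmp)
  | na h _ => exact .na (weaken φ (.na h))

end Deriv

/-- The prime theory lemma: an underivable formula is omitted by some prime theory. -/
theorem exists_primeTheoryIn {Ax S T : Set Fml} {χ : Fml} (hTS : T ⊆ S) (h : ¬ Deriv Ax T χ) :
    ∃ Δ, PrimeTheoryIn Ax S Δ ∧ T ⊆ Δ ∧ χ ∉ Δ := by
  obtain ⟨M, hTM, hM⟩ := zorn_subset_nonempty {Δ : Set Fml | ¬ Deriv Ax Δ χ}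
    (fun c hcs hc hne => ⟨⋃₀ c, fun hd => by
      obtain ⟨s, hs, hd⟩ := hd.exists_mem_of_sUnion hc hne
      exact hcs hs hd, fun s hs => Set.subset_sUnion_of_mem hs⟩) T h
  have hMχ : ¬ Deriv Ax M χ := hM.prop
  have himp : ∀ φ, φ ∉ M → Deriv Ax M (.imp φ χ) := fun φ hφ => by
    by_contra hd
    exact hφ (hM.le_of_ge (fun hd' => hd hd'.deduction) (Set.subset_insert φ M)
      (Set.mem_insert φ M))
  have hclosed : ∀ φ, Deriv Ax M φ → φ ∈ M := fun φ hφ => by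
    by_contra hn
    exact hMχ (.mp hφ (himp φ hn))
  refine ⟨M ∩ S, ⟨Set.inter_subset_right, ?_, ?_, ?_⟩, Set.subset_inter hTM hTS,
    fun hχ => hMχ (.el hχ.1)⟩
  · exact fun φ hφ hd => ⟨hclosed φ (hd.mono Set.inter_subset_left), hφ⟩
  · exact fun hd => hMχ (.mp (hd.mono Set.inter_subset_left) (.base (.ipc (.botE χ))))
  · intro L _ hLS hd
    by_contra! hn
    exact hMχ (.mp (hd.mono Set.inter_subset_left)
      (Deriv.disj_elim L fun ψ hψ => himp ψ fun hψM => hn ψ hψ ⟨hψM, hLS ψ hψ⟩))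

/-- The segment without successors over a prime theory. -/
def PrimeTheoryIn.toSegment {Ax S Γ : Set Fml} (h : PrimeTheoryIn Ax S Γ) : Segment Ax S :=
  ⟨(Γ, ∅), h, by simp, by simp, by simp⟩

/-- The segment over `Γ` whose successors contain every `⇛`-consequence of `φ` over `Γ`. -/
def PrimeTheoryIn.stoSegment {Ax S Γ : Set Fml} (h : PrimeTheoryIn Ax S Γ) (φ : Fml) :
    Segment Ax S :=
  ⟨(Γ, {Δ | PrimeTheoryIn Ax S Δ ∧ ∀ θ ∈ S, Deriv Ax Γ (.sto φ θ) → θ ∈ Δ}), h,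
    fun _ hΔ => hΔ.1, fun _ hΔ _ hΔ' hs => ⟨hΔ', fun θ hθ hd => hs (hΔ.2 θ hθ hd)⟩, by
    intro α β _ hβ hd hα Δ hΔ
    refine hΔ.2 β hβ (Deriv.sto_trans ?_ hd)
    by_contra hn
    obtain ⟨Δ', hΔ', hsub, hαΔ'⟩ := exists_primeTheoryIn
      (T := {θ | θ ∈ S ∧ Deriv Ax Γ (.sto φ θ)}) (fun _ hθ => hθ.1)
      (fun hα' => hn (Deriv.sto_of_forall (fun _ hθ => hθ.2) hα'))
    exact hαΔ' (hα Δ' ⟨hΔ', fun θ hθ hd => hsub ⟨hθ, hd⟩⟩)⟩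

/-- truth lemma: for every `φ ∈ Σ` and every `(Ax,Σ)`-segment
`(Γ,U)`, truth of `φ` at `(Γ,U)` in the full canonical model is equivalent to
`φ ∈ Γ`. -/
theorem truth_lemma (Ax S : Set Fml) (hcon : Consistent Ax)
    (htop : Fml.top ∈ S) (hsub : SubfClosed S) :
    ∀ φ ∈ S, ∀ w : Segment Ax S, canonSat Ax S φ w ↔ φ ∈ w.1.1 := by
  obtain ⟨hand, hor, himp, hsto⟩ := hsub
  intro φ
  induction φ with
  | var p => exact fun _ _ => Iff.rfl
  | top => exact fun h w => ⟨fun _ => w.2.1.2.1 _ h (.base (.ipc .top)), fun _ => trivial⟩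
  | bot => exact fun _ w => ⟨False.elim, fun h => w.2.1.2.2.1 (.el h)⟩
  | and φ ψ ihφ ihψ =>
    intro h w
    obtain ⟨hφ, hψ⟩ := hand φ ψ h
    have hcl := w.2.1.2.1
    rw [canonSat, ihφ hφ, ihψ hψ]
    exact ⟨fun ⟨h₁, h₂⟩ => hcl _ h (.and_intro (.el h₁) (.el h₂)), fun hw =>
      ⟨hcl _ hφ (.mp (.el hw) (.base (.ipc (.andE1 _ _)))),
        hcl _ hψ (.mp (.el hw) (.base (.ipc (.andE2 _ _))))⟩⟩
  | or φ ψ ihφ ihψ =>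
    intro h w
    obtain ⟨hφ, hψ⟩ := hor φ ψ h
    have hcl := w.2.1.2.1
    rw [canonSat, ihφ hφ, ihψ hψ]
    constructor
    · rintro (h₁ | h₂)
      · exact hcl _ h (.mp (.el h₁) (.base (.ipc (.orI1 _ _))))
      · exact hcl _ h (.mp (.el h₂) (.base (.ipc (.orI2 _ _))))
    · intro hw
      simpa using w.2.1.2.2.2 [φ, ψ] (by simp) (by simp [hφ, hψ]) (.el hw)
  | imp φ ψ ihφ ihψ =>
    intro h w
    obtain ⟨hφ, hψ⟩ := himp φ ψ h
    simp only [canonSat, ihφ hφ, ihψ hψ]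
    constructor
    · intro hw
      refine w.2.1.2.1 _ h (Deriv.deduction ?_)
      by_contra hn
      obtain ⟨Δ, hΔ, hsub, hψΔ⟩ := exists_primeTheoryIn
        (Set.insert_subset hφ w.2.1.1) hn
      exact hψΔ (hw hΔ.toSegment ((Set.subset_insert _ _).trans hsub)
        (hsub (Set.mem_insert _ _)))
    · exact fun hw v hv hφv => v.2.1.2.1 _ hψ (.mp (.el hφv) (.el (hv hw)))
  | sto φ ψ ihφ ihψ =>
    intro h w
    obtain ⟨hφ, hψ⟩ := hsto φ ψ h
    simp only [canonSat, ihφ hφ, ihψ hψ]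
    constructor
    · intro hw
      refine w.2.1.2.1 _ h ?_
      by_contra hn
      obtain ⟨Δ, hΔ, hsub, hψΔ⟩ := exists_primeTheoryIn
        (T := {θ | θ ∈ S ∧ Deriv Ax w.1.1 (.sto φ θ)}) (fun _ hθ => hθ.1)
        (fun hψ' => hn (Deriv.sto_of_forall (fun _ hθ => hθ.2) hψ'))
      exact hψΔ (hw (w.2.1.stoSegment φ) subset_rfl
        (fun v hv => hv.2 φ hφ (.na (.imp_refl φ)))
        hΔ.toSegment ⟨hΔ, fun θ hθ hd => hsub ⟨hθ, hd⟩⟩)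
    · intro hw w' hw' hφU v hv
      exact w'.2.2.2.2 φ ψ hφ hψ (.el (hw' hw))
        (fun Δ hΔ => hφU (w'.2.2.1 Δ hΔ).toSegment hΔ) _ hv
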